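/- Let H be an n-vertex C4-free Halin graph with characteristic tree T, and let e ∈ E(T) be a tree edge whose two endpoints are both non-leaf vertices of T. If the two bounded faces of H incident to e both have size at least 6, then there exists an (n−1)-vertex C4-free Halin graph H′ such that e(H) = e(H′) + 1. -/

import Mathlib

open SimpleGraph

/-- Degree of a vertex as the `ncard` of its neighbour set. -/
noncomputable def ncDeg {V : Type*} (G : SimpleGraph V) (v : V) : ℕ :=
  (G.neighborSet v).ncard

/-- A leaf is a vertex of degree one. -/
def IsLeaf {V : Type*} (G : SimpleGraph V) (v : V) : Prop :=
  ncDeg G v = 1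

/-- A Halin graph, presented by its characteristic tree `T` and outer cycle `C`.
The underlying graph is `T ⊔ C`.  The outer cycle is a `2`-regular connected graph
whose support is exactly the set of leaves of `T`, every non-leaf of `T` has degree
at least three, and the cycle is compatible with a planar embedding: for every edge
`uv` of `T`, the leaves lying in each component of `T - uv` are consecutive on the
cycle, i.e. they induce a connected subgraph of the cycle. -/
structure HalinGraph (V : Type*) [Fintype V] : Type _ where
  /-- the characteristic tree -/
  T : SimpleGraph V
  /-- the outer cycle -/
  C : SimpleGraph V
  tree_isTree : T.IsTree
  four_le_card : 4 ≤ Fintype.card V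
  nonleaf_degree : ∀ v : V, ¬ IsLeaf T v → 3 ≤ ncDeg T v
  support_C : C.support = {v : V | IsLeaf T v}
  two_regular : ∀ v ∈ C.support, ncDeg C v = 2
  cycle_connected : (C.induce C.support).Connected
  planar : ∀ u v : V, T.Adj u v →
    (C.induce {x : V | IsLeaf T x ∧ (T.deleteEdges {s(u, v)}).Reachable u x}).Connected

/-- The Halin graph itself: the (edge-disjoint) union of the tree and the outer cycle. -/
def HalinGraph.graph {V : Type*} [Fintype V] (H : HalinGraph V) : SimpleGraph V :=
  H.T ⊔ H.C

/-- Number of edges of a graph. -/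
noncomputable def eCount {V : Type*} (G : SimpleGraph V) : ℕ :=
  G.edgeSet.ncard

/-- A graph is `C₄`-free iff it contains no cycle of length `4`. -/
def C4Free {V : Type*} (G : SimpleGraph V) : Prop :=
  ∀ (v : V) (w : G.Walk v v), w.IsCycle → w.length ≠ 4

/-- A semi-branching vertex of the characteristic tree: a non-leaf with at least one
leaf neighbour and at least two non-leaf neighbours. -/
def SemiBranching {V : Type*} (T : SimpleGraph V) (v : V) : Prop :=
  ¬ IsLeaf T v ∧ (∃ x, T.Adj v x ∧ IsLeaf T x) ∧
    ∃ x y : V, x ≠ y ∧ T.Adj v x ∧ T.Adj v y ∧ ¬ IsLeaf T x ∧ ¬ IsLeaf T y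

namespace SimpleGraph

variable {V W : Type*} {G : SimpleGraph V}

theorem IsAcyclic.not_reachable_deleteEdges (hG : G.IsAcyclic) {x y : V} (h : G.Adj x y) :
    ¬ (G.deleteEdges {s(x, y)}).Reachable x y :=
  isAcyclic_iff_forall_adj_isBridge.1 hG h

theorem Connected.reachable_deleteEdges_or (hG : G.Connected) (x y z : V) :
    (G.deleteEdges {s(x, y)}).Reachable x z ∨ (G.deleteEdges {s(x, y)}).Reachable y z := by
  obtain ⟨p⟩ := hG.preconnected z x
  induction p with
  | nil => exact Or.inl (Reachable.refl _)
  | @cons a b c h p ih =>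
    by_cases hab : s(a, b) = s(c, y)
    · rcases Sym2.eq_iff.1 hab with ⟨rfl, -⟩ | ⟨rfl, -⟩
      · exact Or.inl (Reachable.refl _)
      · exact Or.inr (Reachable.refl _)
    · have hba : (G.deleteEdges {s(c, y)}).Reachable b a := by
        refine Adj.reachable ?_
        rw [deleteEdges_adj, Set.mem_singleton_iff, Sym2.eq_swap]
        exact ⟨h.symm, hab⟩
      exact ih.imp (·.trans hba) (·.trans hba)

theorem IsAcyclic.notMem_support_of_notMem_edges (hG : G.IsAcyclic) {x y z : V} (hxy : G.Adj x y)
    (p : G.Walk y z) (hp : s(x, y) ∉ p.edges) : x ∉ p.support := by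
  classical
  intro hx
  refine hG.not_reachable_deleteEdges hxy (Reachable.symm ?_)
  exact reachable_deleteEdges_iff_exists_walk.2
    ⟨p.takeUntil x hx, fun h => hp (p.edges_takeUntil_subset_edges hx h)⟩

/-- In a forest, the branch at `x` through `y` lies on the `x`-side of every other edge at `x`. -/
theorem IsAcyclic.reachable_deleteEdges_of_branch (hG : G.IsAcyclic) {x y v z : V}
    (hxy : G.Adj x y) (hne : v ≠ y) (h : (G.deleteEdges {s(x, y)}).Reachable y z) :
    (G.deleteEdges {s(x, v)}).Reachable x z := by
  obtain ⟨p, hp⟩ := reachable_deleteEdges_iff_exists_walk.1 h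
  have hx := hG.notMem_support_of_notMem_edges hxy p hp
  refine reachable_deleteEdges_iff_exists_walk.2 ⟨Walk.cons hxy p, ?_⟩
  rw [Walk.edges_cons, List.mem_cons, not_or]
  exact ⟨fun h' => hne (by grind), fun h' => hx (p.fst_mem_support_of_mem_edges h')⟩

/-- In a forest, distinct branches at a vertex are disjoint. -/
theorem IsAcyclic.eq_of_mem_branches (hG : G.IsAcyclic) {x y₁ y₂ z : V}
    (h₁ : G.Adj x y₁) (h₂ : G.Adj x y₂) (hz₁ : (G.deleteEdges {s(x, y₁)}).Reachable y₁ z)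
    (hz₂ : (G.deleteEdges {s(x, y₂)}).Reachable y₂ z) : y₁ = y₂ := by
  by_contra hne
  exact hG.not_reachable_deleteEdges h₂
    ((hG.reachable_deleteEdges_of_branch h₁ (Ne.symm hne) hz₁).trans hz₂.symm)

theorem Reachable.exists_branch {x z : V} (h : G.Reachable x z) (hne : x ≠ z) :
    ∃ y, G.Adj x y ∧ (G.deleteEdges {s(x, y)}).Reachable y z := by
  classical
  obtain ⟨p, hp⟩ := h.exists_isPath
  cases p with
  | nil => exact absurd rfl hne
  | @cons _ y _ hxy p =>
    rw [Walk.cons_isPath_iff] at hp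
    exact ⟨y, hxy, reachable_deleteEdges_iff_exists_walk.2
      ⟨p, fun h' => hp.2 (p.fst_mem_support_of_mem_edges h')⟩⟩

theorem IsAcyclic.not_adj_of_adj_of_adj (hG : G.IsAcyclic) {x y z : V} (hxy : G.Adj x y)
    (hxz : G.Adj x z) : ¬ G.Adj y z := by
  intro hyz
  refine hG.not_reachable_deleteEdges hyz (reachable_deleteEdges_iff_exists_walk.2
    ⟨Walk.cons hxy.symm (Walk.cons hxz Walk.nil), ?_⟩)
  have := hxy.ne
  have := hxz.ne
  have := hyz.ne
  simp only [Walk.edges_cons, Walk.edges_nil]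
  grind

theorem Connected.eq_of_forall_not_adj {S : Set V} (hS : (G.induce S).Connected) {c z : V}
    (hc : c ∈ S) (hz : z ∈ S) (h : ∀ y ∈ S, ¬ G.Adj c y) : c = z := by
  obtain ⟨p⟩ := hS.preconnected ⟨c, hc⟩ ⟨z, hz⟩
  cases p with
  | nil => rfl
  | @cons _ y _ hcy p => exact absurd hcy (h y.1 y.2)

theorem Connected.induce_image {G' : SimpleGraph W} {S : Set V} (hS : (G.induce S).Connected)
    {f : V → W} (hf : ∀ x ∈ S, ∀ y ∈ S, G.Adj x y → G'.Adj (f x) (f y)) :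
    (G'.induce (f '' S)).Connected := by
  let φ : G.induce S →g G'.induce (f '' S) :=
    { toFun := fun x => ⟨f x.1, x.1, x.2, rfl⟩
      map_rel' := fun {a b} hab => hf _ a.2 _ b.2 hab }
  refine hS.map φ ?_
  rintro ⟨_, x, hx, rfl⟩
  exact ⟨⟨x, hx⟩, rfl⟩

end SimpleGraph

theorem IsLeaf.eq_of_adj {V : Type*} {G : SimpleGraph V} {x y z : V} (h : IsLeaf G x)
    (hy : G.Adj x y) (hz : G.Adj x z) : y = z := by
  obtain ⟨a, ha⟩ := Set.ncard_eq_one.1 h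
  have hy' : y ∈ G.neighborSet x := hy
  have hz' : z ∈ G.neighborSet x := hz
  rw [ha] at hy' hz'
  exact hy'.trans hz'.symm

theorem c4Free_iff {V : Type*} {G : SimpleGraph V} :
    C4Free G ↔ ∀ a b c d, G.Adj a b → G.Adj b c → G.Adj c d → G.Adj d a → a ≠ c → b = d := by
  constructor
  · intro h a b c d hab hbc hcd hda hac
    by_contra hbd
    refine h a (.cons hab (.cons hbc (.cons hcd (.cons hda .nil)))) ?_ rfl
    have := hab.ne
    have := hbc.ne
    have := hcd.ne
    have := hda.ne
    rw [Walk.cons_isCycle_iff, Walk.isPath_def]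
    simp only [Walk.support_cons, Walk.support_nil, Walk.edges_cons, Walk.edges_nil]
    grind
  · intro h a w hw hlen
    match w, hw, hlen with
    | .cons hab (.cons hbc (.cons hcd (.cons hda .nil))), hw, _ =>
      rw [Walk.cons_isCycle_iff, Walk.isPath_def] at hw
      have := h _ _ _ _ hab hbc hcd hda
      simp only [Walk.support_cons, Walk.support_nil, Walk.edges_cons, Walk.edges_nil] at hw
      grind

namespace HalinGraph

variable {V : Type*} [Fintype V] (H : HalinGraph V)

theorem isLeaf_of_adj_C {x y : V} (h : H.C.Adj x y) : IsLeaf H.T x := by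
  have hx : x ∈ H.C.support := ⟨y, h⟩
  rwa [H.support_C] at hx

theorem not_adj_T_of_isLeaf {x y : V} (hx : IsLeaf H.T x) (hy : IsLeaf H.T y) :
    ¬ H.T.Adj x y := by
  classical
  intro hxy
  obtain ⟨z, hz⟩ : ∃ z, z ∉ ({x, y} : Finset V) := by
    by_contra! hall
    have hcard : Fintype.card V ≤ ({x, y} : Finset V).card :=
      Finset.card_le_card fun z _ => hall z
    have := hcard.trans Finset.card_le_two
    have := H.four_le_card
    omega
  rw [Finset.mem_insert, Finset.mem_singleton, not_or] at hz
  rcases H.tree_isTree.connected.reachable_deleteEdges_or x y z with h | h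
  · obtain ⟨w, hw, -⟩ := h.exists_branch (Ne.symm hz.1)
    rw [deleteEdges_adj] at hw
    exact hw.2 (by rw [hx.eq_of_adj hw.1 hxy]; rfl)
  · obtain ⟨w, hw, -⟩ := h.exists_branch (Ne.symm hz.2)
    rw [deleteEdges_adj] at hw
    exact hw.2 (by rw [hy.eq_of_adj hw.1 hxy.symm, Sym2.eq_swap]; rfl)

theorem eCount_graph : eCount H.graph = eCount H.T + eCount H.C := by
  have hdisj : Disjoint H.T.edgeSet H.C.edgeSet := by
    rw [Set.disjoint_left]
    intro e
    induction e with
    | _ x y =>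
      intro hT hC
      exact H.not_adj_T_of_isLeaf (H.isLeaf_of_adj_C hC) (H.isLeaf_of_adj_C (Adj.symm hC)) hT
  rw [eCount, graph, edgeSet_sup, Set.ncard_union_eq hdisj (Set.toFinite _) (Set.toFinite _)]
  rfl

theorem eCount_T : eCount H.T + 1 = Fintype.card V := by
  rw [← Nat.card_eq_fintype_card, ← (isTree_iff_connected_and_card.1 H.tree_isTree).2,
    eCount, Set.ncard]
  rfl

theorem eq_or_eq_of_adj_C {a b c y : V} (ha : H.C.Adj c a) (hb : H.C.Adj c b) (hab : a ≠ b)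
    (hy : H.C.Adj c y) : y = a ∨ y = b := by
  have hsub : ({a, b} : Set V) ⊆ H.C.neighborSet c := by
    rintro z (rfl | rfl)
    exacts [ha, hb]
  have hdeg : (H.C.neighborSet c).ncard = 2 := H.two_regular c ⟨a, ha⟩
  have heq := Set.eq_of_subset_of_ncard_le hsub (by rw [hdeg, Set.ncard_pair hab])
    (Set.toFinite _)
  have hy' : y ∈ H.C.neighborSet c := hy
  rwa [← heq] at hy'

theorem exists_isLeaf_branch {x y : V} (h : H.T.Adj x y) :
    ∃ l, IsLeaf H.T l ∧ (H.T.deleteEdges {s(x, y)}).Reachable y l := by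
  obtain ⟨⟨l, hl⟩⟩ := (H.planar y x h.symm).nonempty
  rw [Sym2.eq_swap] at hl
  exact ⟨l, hl⟩

/-- A branch hanging at a non-leaf vertex contains at least two leaves. -/
theorem exists_pair_isLeaf_branch {v x : V} (hx : ¬ IsLeaf H.T x) :
    ∃ l₁ l₂, l₁ ≠ l₂ ∧
      (IsLeaf H.T l₁ ∧ (H.T.deleteEdges {s(x, v)}).Reachable x l₁) ∧
      (IsLeaf H.T l₂ ∧ (H.T.deleteEdges {s(x, v)}).Reachable x l₂) := by
  have hdeg : 3 ≤ (H.T.neighborSet x).ncard := H.nonleaf_degree x hx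
  have hcard : 1 < (H.T.neighborSet x \ {v}).ncard := by
    have := Set.le_ncard_sdiff {v} (H.T.neighborSet x)
    rw [Set.ncard_singleton] at this
    omega
  obtain ⟨y₁, ⟨h₁, hv₁⟩, y₂, ⟨h₂, hv₂⟩, hne⟩ := (Set.one_lt_ncard (Set.toFinite _)).1 hcard
  obtain ⟨l₁, hl₁, hr₁⟩ := H.exists_isLeaf_branch h₁
  obtain ⟨l₂, hl₂, hr₂⟩ := H.exists_isLeaf_branch h₂
  have hT := H.tree_isTree.isAcyclic
  refine ⟨l₁, l₂, ?_, ⟨hl₁, hT.reachable_deleteEdges_of_branch h₁ (Ne.symm hv₁) hr₁⟩,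
    ⟨hl₂, hT.reachable_deleteEdges_of_branch h₂ (Ne.symm hv₂) hr₂⟩⟩
  rintro rfl
  exact hne (hT.eq_of_mem_branches h₁ h₂ hr₁ hr₂)

/-- If both neighbours of `c` on the outer cycle hang at the ends of the tree edge `uv`, then `c`
is adjacent to the end of `uv` on its own side. -/
theorem adj_T_of_adj_C_of_adj_C {u v a b c : V} (huv : H.T.Adj u v) (hv : ¬ IsLeaf H.T v)
    (hua : H.T.Adj u a) (hvb : H.T.Adj v b) (hav : a ≠ v) (hab : a ≠ b)
    (hca : H.C.Adj c a) (hcb : H.C.Adj c b)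
    (hc : (H.T.deleteEdges {s(u, v)}).Reachable v c) : H.T.Adj v c := by
  have hT := H.tree_isTree.isAcyclic
  have hcl := H.isLeaf_of_adj_C hca
  have hvc : v ≠ c := fun h => hv (h ▸ hcl)
  obtain ⟨x, hvx, hxc⟩ := (H.tree_isTree.connected.preconnected v c).exists_branch hvc
  have huv' := huv.ne
  have hxu : x ≠ u := by
    rintro rfl
    rw [Sym2.eq_swap] at hc
    exact hT.not_reachable_deleteEdges hvx (hc.trans hxc.symm)
  have hxb : x ≠ b := by
    rintro rfl
    obtain ⟨w, hw, -⟩ := hxc.exists_branch hcb.ne'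
    rw [deleteEdges_adj] at hw
    refine hw.2 ?_
    rw [(H.isLeaf_of_adj_C hcb.symm).eq_of_adj hw.1 hvx.symm, Sym2.eq_swap]
    rfl
  have hva : (H.T.deleteEdges {s(v, x)}).Reachable v a := by
    have h₁ : (H.T.deleteEdges {s(v, x)}).Adj v u := by
      rw [deleteEdges_adj, Set.mem_singleton_iff]
      exact ⟨huv.symm, by grind⟩
    have h₂ : (H.T.deleteEdges {s(v, x)}).Adj u a := by
      rw [deleteEdges_adj, Set.mem_singleton_iff]
      exact ⟨hua, by grind⟩
    exact h₁.reachable.trans h₂.reachable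
  have hvb' : (H.T.deleteEdges {s(v, x)}).Reachable v b := by
    refine Adj.reachable ?_
    rw [deleteEdges_adj, Set.mem_singleton_iff]
    exact ⟨hvb, by grind⟩
  have honly : ∀ z, IsLeaf H.T z ∧ (H.T.deleteEdges {s(x, v)}).Reachable x z → c = z := by
    intro z hz
    refine (H.planar x v hvx.symm).eq_of_forall_not_adj ⟨hcl, ?_⟩ hz ?_
    · rwa [Sym2.eq_swap]
    · rintro y ⟨-, hy⟩ hcy
      rw [Sym2.eq_swap] at hy
      rcases H.eq_or_eq_of_adj_C hca hcb hab hcy with rfl | rfl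
      · exact hT.not_reachable_deleteEdges hvx (hva.trans hy.symm)
      · exact hT.not_reachable_deleteEdges hvx (hvb'.trans hy.symm)
  by_cases hx : IsLeaf H.T x
  · exact honly x ⟨hx, Reachable.refl _⟩ ▸ hvx
  · obtain ⟨l₁, l₂, hne, h₁, h₂⟩ := H.exists_pair_isLeaf_branch (v := v) hx
    exact absurd ((honly l₁ h₁).symm.trans (honly l₂ h₂)) hne

theorem graph_adj {x y : V} : H.graph.Adj x y ↔ H.T.Adj x y ∨ H.C.Adj x y := Iff.rfl

theorem adj_T_of_not_isLeaf {x y : V} (hx : ¬ IsLeaf H.T x) (h : H.graph.Adj x y) :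
    H.T.Adj x y :=
  h.resolve_right fun h' => hx (H.isLeaf_of_adj_C h')

/-- When every bounded face at the tree edge `uv` is large, `uv` lies on no `5`-cycle. -/
theorem false_of_five_cycle {u v a b c : V} (huv : H.T.Adj u v)
    (hu : ¬ IsLeaf H.T u) (hv : ¬ IsLeaf H.T v)
    (hface : ∀ w₁ w₂ : V, H.C.Adj w₁ w₂ → ∀ p : H.T.Walk w₁ w₂, p.IsPath → s(u, v) ∈ p.edges →
      5 ≤ p.length)
    (hua : H.T.Adj u a) (hvb : H.T.Adj v b) (hav : a ≠ v) (hbu : b ≠ u) (hcu : c ≠ u)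
    (hcv : c ≠ v) (hca : H.graph.Adj c a) (hcb : H.graph.Adj c b) : False := by
  have hT := H.tree_isTree.isAcyclic
  have hab : a ≠ b := by
    rintro rfl
    exact hT.not_adj_of_adj_of_adj huv hua hvb
  have := huv.ne
  have := hua.ne
  have := hvb.ne
  have := hca.ne
  have := hcb.ne
  rcases hca with hca | hca <;> rcases hcb with hcb | hcb
  · refine hT.not_reachable_deleteEdges huv (reachable_deleteEdges_iff_exists_walk.2
      ⟨.cons hua (.cons hca.symm (.cons hcb (.cons hvb.symm .nil))), ?_⟩)
    simp only [Walk.edges_cons, Walk.edges_nil]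
    grind
  · have hp := hface c b hcb (.cons hca (.cons hua.symm (.cons huv (.cons hvb .nil))))
      (by rw [Walk.isPath_def]; simp only [Walk.support_cons, Walk.support_nil]; grind)
      (by simp)
    simp at hp
  · have hp := hface c a hca (.cons hcb (.cons hvb.symm (.cons huv.symm (.cons hua .nil))))
      (by rw [Walk.isPath_def]; simp only [Walk.support_cons, Walk.support_nil]; grind)
      (by simp)
    simp at hp
  · rcases H.tree_isTree.connected.reachable_deleteEdges_or u v c with h | h
    · rw [Sym2.eq_swap] at h
      have huc := H.adj_T_of_adj_C_of_adj_C huv.symm hu hvb hua hbu hab.symm hcb hca h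
      have hp := hface c b hcb (.cons huc.symm (.cons huv (.cons hvb .nil)))
        (by rw [Walk.isPath_def]; simp only [Walk.support_cons, Walk.support_nil]; grind)
        (by simp)
      simp at hp
    · have hvc := H.adj_T_of_adj_C_of_adj_C huv hv hua hvb hav hab hca hcb h
      have hp := hface c a hca (.cons hvc.symm (.cons huv.symm (.cons hua .nil)))
        (by rw [Walk.isPath_def]; simp only [Walk.support_cons, Walk.support_nil]; grind)
        (by simp)
      simp at hp

end HalinGraph

namespace SimpleGraph

variable {V W : Type*} {G : SimpleGraph V} {G' : SimpleGraph W} {f : V → W}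

theorem Reachable.of_forall_adj_imp (hf : ∀ x y, G.Adj x y → f x = f y ∨ G'.Adj (f x) (f y))
    {x y : V} (h : G.Reachable x y) : G'.Reachable (f x) (f y) := by
  obtain ⟨p⟩ := h
  induction p with
  | nil => exact Reachable.refl _
  | cons hab p ih =>
    rcases hf _ _ hab with h | h
    · rwa [h]
    · exact h.reachable.trans ih

theorem Reachable.lift (hfib : ∀ x y, f x = f y → G.Reachable x y)
    (hadj : ∀ a b, G'.Adj a b → ∃ x y, G.Adj x y ∧ f x = a ∧ f y = b)
    {x y : V} (h : G'.Reachable (f x) (f y)) : G.Reachable x y := by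
  obtain ⟨p⟩ := h
  suffices ∀ a b, G'.Walk a b → ∀ x y, f x = a → f y = b → G.Reachable x y from
    this _ _ p x y rfl rfl
  intro a b p
  induction p with
  | nil => exact fun x y hx hy => hfib x y (hx.trans hy.symm)
  | cons hab p ih =>
    intro x y hx hy
    obtain ⟨x', y', h, rfl, rfl⟩ := hadj _ _ hab
    exact ((hfib _ _ hx).trans h.reachable).trans (ih y' y rfl hy)

end SimpleGraph

/-- The map `f` is a surjection whose only nontrivial fibre is `{u, v}`. -/
structure IsContraction {V W : Type*} (f : V → W) (u v : V) : Prop where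
  surjective : Function.Surjective f
  eq_iff : ∀ x y, f x = f y ↔ x = y ∨ (x = u ∧ y = v) ∨ (x = v ∧ y = u)

namespace IsContraction

variable {V W : Type*} {f : V → W} {u v : V} {G : SimpleGraph V}

theorem apply_eq (hf : IsContraction f u v) : f u = f v := by
  rw [hf.eq_iff]
  grind

theorem exists_adj_of_map_adj {a b : W} (h : (G.map f).Adj a b) :
    ∃ x y, G.Adj x y ∧ f x = a ∧ f y = b :=
  h.2

theorem adj_of_map_adj (hf : IsContraction f u v) {x y : V} (hxu : x ≠ u) (hxv : x ≠ v)
    (hyu : y ≠ u) (hyv : y ≠ v) (h : (G.map f).Adj (f x) (f y)) : G.Adj x y := by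
  obtain ⟨p, q, hpq, hp, hq⟩ := exists_adj_of_map_adj h
  rw [hf.eq_iff] at hp hq
  grind

theorem adj_or_adj_of_map_adj (hf : IsContraction f u v) {y : V} (hyu : y ≠ u) (hyv : y ≠ v)
    (h : (G.map f).Adj (f u) (f y)) : G.Adj u y ∨ G.Adj v y := by
  obtain ⟨p, q, hpq, hp, hq⟩ := exists_adj_of_map_adj h
  rw [hf.eq_iff] at hp hq
  grind

theorem neighborSet_map (hf : IsContraction f u v) {x : V} (hxu : x ≠ u) (hxv : x ≠ v) :
    (G.map f).neighborSet (f x) = f '' G.neighborSet x := by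
  ext b
  constructor
  · intro h
    obtain ⟨p, q, hpq, hp, rfl⟩ := exists_adj_of_map_adj h
    rw [hf.eq_iff] at hp
    obtain rfl : p = x := by grind
    exact ⟨q, hpq, rfl⟩
  · rintro ⟨y, hy, rfl⟩
    refine map_adj_apply' hy fun h => ?_
    have hne := G.ne_of_adj hy
    rw [hf.eq_iff] at h
    grind

theorem ncDeg_map (hf : IsContraction f u v) {x : V} (hxu : x ≠ u) (hxv : x ≠ v)
    (h : ¬ (G.Adj x u ∧ G.Adj x v)) : ncDeg (G.map f) (f x) = ncDeg G x := by
  rw [ncDeg, ncDeg, hf.neighborSet_map hxu hxv]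
  refine Set.InjOn.ncard_image fun y hy z hz hyz => ?_
  have hy' : G.Adj x y := hy
  have hz' : G.Adj x z := hz
  rw [hf.eq_iff] at hyz
  grind

/-- Contracting an edge of a forest identifies no two of the remaining edges. -/
theorem edge_eq (hf : IsContraction f u v) (hG : G.IsAcyclic) (huv : G.Adj u v) {x y p q : V}
    (hxy : G.Adj x y) (hpq : G.Adj p q) (hne : f x ≠ f y) (h : s(f p, f q) = s(f x, f y)) :
    s(p, q) = s(x, y) := by
  have htri : ∀ z, G.Adj u z → ¬ G.Adj v z := fun z hz hz' =>
    hG.not_adj_of_adj_of_adj huv hz hz'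
  have h₁ := htri x
  have h₂ := htri y
  have := hxy.symm
  have := hpq.symm
  rw [Sym2.eq_iff] at h ⊢
  rw [Ne, hf.eq_iff] at hne
  simp only [hf.eq_iff] at h
  grind

theorem reachable_map_deleteEdges_iff (hf : IsContraction f u v) (hG : G.IsAcyclic)
    (huv : G.Adj u v) {x y : V} (hxy : G.Adj x y) (hne : f x ≠ f y) {p q : V} :
    ((G.map f).deleteEdges {s(f x, f y)}).Reachable (f p) (f q) ↔
      (G.deleteEdges {s(x, y)}).Reachable p q := by
  constructor
  · refine Reachable.lift (fun a b hab => ?_) (fun a b hab => ?_)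
    · have huv' : (G.deleteEdges {s(x, y)}).Adj u v := by
        rw [deleteEdges_adj, Set.mem_singleton_iff]
        refine ⟨huv, fun h => hne ?_⟩
        rw [hf.eq_iff]
        grind
      rcases (hf.eq_iff a b).1 hab with rfl | ⟨rfl, rfl⟩ | ⟨rfl, rfl⟩
      · exact Reachable.refl _
      · exact huv'.reachable
      · exact huv'.symm.reachable
    · rw [deleteEdges_adj, Set.mem_singleton_iff] at hab
      obtain ⟨a', b', h, rfl, rfl⟩ := exists_adj_of_map_adj hab.1
      refine ⟨a', b', ?_, rfl, rfl⟩
      rw [deleteEdges_adj, Set.mem_singleton_iff]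
      exact ⟨h, fun h' => hab.2 (by simpa using congrArg (Sym2.map f) h')⟩
  · refine Reachable.of_forall_adj_imp fun a b hab => ?_
    rw [deleteEdges_adj, Set.mem_singleton_iff] at hab
    by_cases hfab : f a = f b
    · exact Or.inl hfab
    · refine Or.inr ?_
      rw [deleteEdges_adj, Set.mem_singleton_iff]
      exact ⟨map_adj_apply' hab.1 hfab,
        fun h => hab.2 (hf.edge_eq hG huv hxy hab.1 hne h)⟩

theorem connected_map (hf : IsContraction f u v) (hG : G.Connected) : (G.map f).Connected := by
  have := hG.nonempty.map f
  refine ⟨fun a b => ?_⟩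
  obtain ⟨x, rfl⟩ := hf.surjective a
  obtain ⟨y, rfl⟩ := hf.surjective b
  refine (hG.preconnected x y).of_forall_adj_imp fun p q hpq => ?_
  by_cases h : f p = f q
  · exact Or.inl h
  · exact Or.inr (map_adj_apply' hpq h)

theorem isTree_map [Fintype V] [Fintype W] (hf : IsContraction f u v) (hG : G.IsTree)
    (huv : G.Adj u v) (hcard : Fintype.card W + 1 = Fintype.card V) : (G.map f).IsTree := by
  have hconn := hf.connected_map hG.connected
  refine isTree_iff_connected_and_card.2 ⟨hconn, le_antisymm ?_
    hconn.card_vert_le_card_edgeSet_add_one⟩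
  have hsub : (G.map f).edgeSet ⊆ Sym2.map f '' (G.edgeSet \ {s(u, v)}) := by
    intro e
    induction e with
    | _ a b =>
      intro hab
      obtain ⟨x, y, hxy, rfl, rfl⟩ := exists_adj_of_map_adj hab
      refine ⟨s(x, y), ⟨hxy, fun h => (G.map f).ne_of_adj hab ?_⟩, rfl⟩
      rw [Set.mem_singleton_iff] at h
      rw [hf.eq_iff]
      grind
  have h₁ := (Set.ncard_le_ncard hsub (Set.toFinite _)).trans (Set.ncard_image_le (Set.toFinite _))
  have h₂ := Set.ncard_sdiff_singleton_add_one (show s(u, v) ∈ G.edgeSet from huv) (Set.toFinite _)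
  have h₃ := (isTree_iff_connected_and_card.1 hG).2
  rw [Nat.card_eq_fintype_card (α := V), ← hcard] at h₃
  rw [Nat.card_eq_fintype_card (α := W)]
  change G.edgeSet.ncard + 1 = _ at h₃
  change (G.map f).edgeSet.ncard + 1 ≤ _
  omega

theorem three_le_ncDeg_map [Finite V] (hf : IsContraction f u v) (hG : G.IsAcyclic)
    (huv : G.Adj u v) (hu : 3 ≤ ncDeg G u) (hv : 3 ≤ ncDeg G v) :
    3 ≤ ncDeg (G.map f) (f u) := by
  have huv' := huv.ne
  set A : Set V := G.neighborSet u \ {v}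
  set B : Set V := G.neighborSet v \ {u}
  have hA : 2 ≤ A.ncard := by
    have : _ ≤ A.ncard := Set.le_ncard_sdiff {v} (G.neighborSet u)
    rw [Set.ncard_singleton] at this
    change 3 ≤ (G.neighborSet u).ncard at hu
    omega
  have hB : 2 ≤ B.ncard := by
    have : _ ≤ B.ncard := Set.le_ncard_sdiff {u} (G.neighborSet v)
    rw [Set.ncard_singleton] at this
    change 3 ≤ (G.neighborSet v).ncard at hv
    omega
  have hAB : Disjoint A B := Set.disjoint_left.2 fun x hx hx' =>
    hG.not_adj_of_adj_of_adj huv hx.1 hx'.1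
  have hA' : ∀ x ∈ A, x ≠ u ∧ x ≠ v := fun x hx => ⟨(G.ne_of_adj hx.1).symm, hx.2⟩
  have hB' : ∀ x ∈ B, x ≠ u ∧ x ≠ v := fun x hx => ⟨hx.2, (G.ne_of_adj hx.1).symm⟩
  have hinj : Set.InjOn f (A ∪ B) := by
    intro x hx y hy hxy
    rw [hf.eq_iff] at hxy
    grind
  have hsub : f '' (A ∪ B) ⊆ (G.map f).neighborSet (f u) := by
    rintro _ ⟨x, hx, rfl⟩
    have hne : f u ≠ f x := by
      rw [Ne, hf.eq_iff]
      grind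
    rcases hx with hx | hx
    · exact map_adj_apply' hx.1 hne
    · change (G.map f).Adj (f u) (f x)
      rw [hf.apply_eq] at hne ⊢
      exact map_adj_apply' hx.1 hne
  have hfin : ((G.map f).neighborSet (f u)).Finite :=
    have := Finite.of_surjective f hf.surjective
    Set.toFinite _
  have := Set.ncard_le_ncard hsub hfin
  rw [hinj.ncard_image, Set.ncard_union_eq hAB (Set.toFinite _) (Set.toFinite _)]
    at this
  change 3 ≤ ((G.map f).neighborSet (f u)).ncard
  omega

end IsContraction

namespace HalinGraph

variable {V W : Type*} [Fintype V] (H : HalinGraph V) {f : V → W} {u v : V}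

theorem isLeaf_map_iff (hf : IsContraction f u v) (huv : H.T.Adj u v) (hu : ¬ IsLeaf H.T u)
    (hv : ¬ IsLeaf H.T v) (x : V) : IsLeaf (H.T.map f) (f x) ↔ IsLeaf H.T x := by
  have hT := H.tree_isTree.isAcyclic
  have hfu : ¬ IsLeaf (H.T.map f) (f u) := by
    have := hf.three_le_ncDeg_map hT huv (H.nonleaf_degree u hu) (H.nonleaf_degree v hv)
    rw [IsLeaf]
    omega
  by_cases hxu : x = u
  · simp only [hxu, hfu, hu]
  by_cases hxv : x = v
  · simp only [hxv, ← hf.apply_eq, hfu, hv]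
  rw [IsLeaf, IsLeaf, hf.ncDeg_map hxu hxv fun h => hT.not_adj_of_adj_of_adj h.1 h.2 huv]

theorem map_C_adj_iff (hf : IsContraction f u v) (hu : ¬ IsLeaf H.T u)
    (hv : ¬ IsLeaf H.T v) {x y : V} : (H.C.map f).Adj (f x) (f y) ↔ H.C.Adj x y := by
  have hleaf : ∀ p q, H.C.Adj p q → p ≠ u ∧ p ≠ v := fun p q h =>
    ⟨fun h' => hu (h' ▸ H.isLeaf_of_adj_C h), fun h' => hv (h' ▸ H.isLeaf_of_adj_C h)⟩
  constructor
  · intro h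
    obtain ⟨p, q, hpq, hp, hq⟩ := IsContraction.exists_adj_of_map_adj h
    have := hleaf p q hpq
    have := hleaf q p hpq.symm
    rw [hf.eq_iff] at hp hq
    grind
  · intro h
    refine map_adj_apply' h fun h' => ?_
    have := hleaf x y h
    have := h.ne
    rw [hf.eq_iff] at h'
    grind

theorem support_map_C (hf : IsContraction f u v) (hu : ¬ IsLeaf H.T u)
    (hv : ¬ IsLeaf H.T v) : (H.C.map f).support = f '' H.C.support := by
  ext b
  constructor
  · rintro ⟨c, h⟩
    obtain ⟨x, y, hxy, rfl, -⟩ := IsContraction.exists_adj_of_map_adj h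
    exact ⟨x, ⟨y, hxy⟩, rfl⟩
  · rintro ⟨x, ⟨y, hxy⟩, rfl⟩
    exact ⟨f y, (H.map_C_adj_iff hf hu hv).2 hxy⟩

theorem eCount_map_C (hf : IsContraction f u v) (hu : ¬ IsLeaf H.T u)
    (hv : ¬ IsLeaf H.T v) : eCount (H.C.map f) = eCount H.C := by
  have himage : (H.C.map f).edgeSet = Sym2.map f '' H.C.edgeSet := by
    ext e
    constructor
    · induction e with
      | _ a b =>
        intro hab
        obtain ⟨x, y, hxy, rfl, rfl⟩ := IsContraction.exists_adj_of_map_adj hab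
        exact ⟨s(x, y), hxy, rfl⟩
    · rintro ⟨e, he, rfl⟩
      induction e with
      | _ x y => exact (H.map_C_adj_iff hf hu hv).2 he
  rw [eCount, eCount, himage]
  refine Set.InjOn.ncard_image fun e he e' he' hee' => ?_
  induction e with
  | _ x y =>
    induction e' with
    | _ p q =>
      have hleaf : ∀ p q, H.C.Adj p q → p ≠ u ∧ p ≠ v := fun p q h =>
        ⟨fun h' => hu (h' ▸ H.isLeaf_of_adj_C h), fun h' => hv (h' ▸ H.isLeaf_of_adj_C h)⟩
      have := hleaf x y he
      have := hleaf y x (Adj.symm he)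
      rw [Sym2.map_mk, Sym2.map_mk, Sym2.eq_iff] at hee'
      simp only [hf.eq_iff] at hee'
      rw [Sym2.eq_iff]
      grind

variable [Fintype W]

/-- The Halin graph obtained by contracting a tree edge `uv` between two non-leaves. -/
def contract (hf : IsContraction f u v) (hcard : Fintype.card W + 1 = Fintype.card V)
    (huv : H.T.Adj u v) (hu : ¬ IsLeaf H.T u) (hv : ¬ IsLeaf H.T v) : HalinGraph W where
  T := H.T.map f
  C := H.C.map f
  tree_isTree := hf.isTree_map H.tree_isTree huv hcard
  four_le_card := by
    have h₁ : 3 ≤ ((H.T.map f).neighborSet (f u)).ncard :=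
      hf.three_le_ncDeg_map H.tree_isTree.isAcyclic huv
        (H.nonleaf_degree u hu) (H.nonleaf_degree v hv)
    have h₂ : f u ∉ (H.T.map f).neighborSet (f u) := (H.T.map f).irrefl
    have h₃ := Set.ncard_le_card (insert (f u) ((H.T.map f).neighborSet (f u)))
    rw [Set.ncard_insert_of_notMem h₂ (Set.toFinite _), Nat.card_eq_fintype_card] at h₃
    omega
  nonleaf_degree := by
    intro b hb
    obtain ⟨x, rfl⟩ := hf.surjective b
    have hT := H.tree_isTree.isAcyclic
    have h₃ := hf.three_le_ncDeg_map hT huv (H.nonleaf_degree u hu) (H.nonleaf_degree v hv)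
    by_cases hxu : x = u
    · rwa [hxu]
    by_cases hxv : x = v
    · rwa [hxv, ← hf.apply_eq]
    rw [hf.ncDeg_map hxu hxv fun h => hT.not_adj_of_adj_of_adj h.1 h.2 huv]
    exact H.nonleaf_degree x fun h => hb ((H.isLeaf_map_iff hf huv hu hv x).2 h)
  support_C := by
    rw [H.support_map_C hf hu hv, H.support_C]
    ext b
    obtain ⟨x, rfl⟩ := hf.surjective b
    rw [Set.mem_ofPred_eq, H.isLeaf_map_iff hf huv hu hv]
    constructor
    · rintro ⟨y, hy, hyx⟩
      rw [← H.isLeaf_map_iff hf huv hu hv, ← hyx]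
      exact (H.isLeaf_map_iff hf huv hu hv y).2 hy
    · exact fun hx => ⟨x, hx, rfl⟩
  two_regular := by
    rw [H.support_map_C hf hu hv]
    rintro _ ⟨x, hx, rfl⟩
    obtain ⟨y, hxy⟩ := hx
    have hxl := H.isLeaf_of_adj_C hxy
    rw [hf.ncDeg_map (fun h => hu (h ▸ hxl)) (fun h => hv (h ▸ hxl))
      fun h => hu (H.isLeaf_of_adj_C h.1.symm)]
    exact H.two_regular x ⟨y, hxy⟩
  cycle_connected := by
    rw [H.support_map_C hf hu hv]
    exact H.cycle_connected.induce_image fun x _ y _ => (H.map_C_adj_iff hf hu hv).2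
  planar := by
    intro a b hab
    obtain ⟨x, y, hxy, rfl, rfl⟩ := IsContraction.exists_adj_of_map_adj hab
    have himage : {z : W | IsLeaf (H.T.map f) z ∧
        ((H.T.map f).deleteEdges {s(f x, f y)}).Reachable (f x) z} =
        f '' {z : V | IsLeaf H.T z ∧ (H.T.deleteEdges {s(x, y)}).Reachable x z} := by
      have hiff : ∀ z : V, (IsLeaf (H.T.map f) (f z) ∧
          ((H.T.map f).deleteEdges {s(f x, f y)}).Reachable (f x) (f z)) ↔
          (IsLeaf H.T z ∧ (H.T.deleteEdges {s(x, y)}).Reachable x z) := fun z => by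
        rw [H.isLeaf_map_iff hf huv hu hv, hf.reachable_map_deleteEdges_iff
          H.tree_isTree.isAcyclic huv hxy ((H.T.map f).ne_of_adj hab)]
      ext c
      constructor
      · obtain ⟨z, rfl⟩ := hf.surjective c
        exact fun hz => ⟨z, (hiff z).1 hz, rfl⟩
      · rintro ⟨z, hz, rfl⟩
        exact (hiff z).2 hz
    rw [himage]
    exact (H.planar x y hxy).induce_image fun x _ y _ => (H.map_C_adj_iff hf hu hv).2

theorem contract_graph (hf : IsContraction f u v) (hcard : Fintype.card W + 1 = Fintype.card V)
    (huv : H.T.Adj u v) (hu : ¬ IsLeaf H.T u) (hv : ¬ IsLeaf H.T v) :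
    (H.contract hf hcard huv hu hv).graph = H.graph.map f := by
  ext a b
  change (H.T.map f).Adj a b ∨ (H.C.map f).Adj a b ↔ (H.graph.map f).Adj a b
  simp only [map_adj', graph_adj]
  grind

theorem eCount_contract_graph (hf : IsContraction f u v)
    (hcard : Fintype.card W + 1 = Fintype.card V)
    (huv : H.T.Adj u v) (hu : ¬ IsLeaf H.T u) (hv : ¬ IsLeaf H.T v) :
    eCount H.graph = eCount (H.contract hf hcard huv hu hv).graph + 1 := by
  have h₁ := H.eCount_T
  have h₂ := (H.contract hf hcard huv hu hv).eCount_T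
  have h₃ : eCount (H.contract hf hcard huv hu hv).C = eCount H.C := H.eCount_map_C hf hu hv
  rw [eCount_graph, eCount_graph, h₃]
  omega

theorem c4Free_contract (hf : IsContraction f u v) (hcard : Fintype.card W + 1 = Fintype.card V)
    (huv : H.T.Adj u v) (hu : ¬ IsLeaf H.T u) (hv : ¬ IsLeaf H.T v) (hfree : C4Free H.graph)
    (hface : ∀ w₁ w₂ : V, H.C.Adj w₁ w₂ → ∀ p : H.T.Walk w₁ w₂, p.IsPath → s(u, v) ∈ p.edges →
      5 ≤ p.length) :
    C4Free (H.contract hf hcard huv hu hv).graph := by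
  rw [contract_graph, c4Free_iff]
  rw [c4Free_iff] at hfree
  have hlift : ∀ b, b ≠ f u → ∃ x, f x = b ∧ x ≠ u ∧ x ≠ v := by
    intro b hb
    obtain ⟨x, rfl⟩ := hf.surjective b
    exact ⟨x, rfl, fun h => hb (h ▸ rfl), fun h => hb (h ▸ hf.apply_eq.symm)⟩
  have hmerged : ∀ b c d, (H.graph.map f).Adj (f u) b → (H.graph.map f).Adj b c →
      (H.graph.map f).Adj c d → (H.graph.map f).Adj d (f u) → f u ≠ c → b = d := by
    intro b c d hab hbc hcd hda hac
    obtain ⟨b, rfl, hbu, hbv⟩ := hlift b hab.ne'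
    obtain ⟨c, rfl, hcu, hcv⟩ := hlift c hac.symm
    obtain ⟨d, rfl, hdu, hdv⟩ := hlift d hda.ne
    have hbc' := hf.adj_of_map_adj hbu hbv hcu hcv hbc
    have hcd' := hf.adj_of_map_adj hcu hcv hdu hdv hcd
    rcases hf.adj_or_adj_of_map_adj hbu hbv hab with hb | hb <;>
      rcases hf.adj_or_adj_of_map_adj hdu hdv hda.symm with hd | hd
    · rw [hfree u b c d hb hbc' hcd' hd.symm hcu.symm]
    · exact (H.false_of_five_cycle huv hu hv hface (H.adj_T_of_not_isLeaf hu hb)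
        (H.adj_T_of_not_isLeaf hv hd) hbv hdu hcu hcv hbc'.symm hcd').elim
    · exact (H.false_of_five_cycle huv hu hv hface (H.adj_T_of_not_isLeaf hu hd)
        (H.adj_T_of_not_isLeaf hv hb) hdv hbu hcu hcv hcd' hbc'.symm).elim
    · rw [hfree v b c d hb hbc' hcd' hd.symm hcv.symm]
  intro a b c d hab hbc hcd hda hac
  by_cases ha : a = f u
  · subst ha
    exact hmerged b c d hab hbc hcd hda hac
  by_cases hb : b = f u
  · subst hb
    by_contra hbd
    exact hac (hmerged c d a hbc hcd hda hab hbd).symm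
  by_cases hc : c = f u
  · subst hc
    exact (hmerged d a b hcd hda hab hbc hac.symm).symm
  by_cases hd : d = f u
  · subst hd
    by_contra hbd
    exact hac (hmerged a b c hda hab hbc hcd (Ne.symm hbd))
  obtain ⟨a, rfl, hau, hav⟩ := hlift a ha
  obtain ⟨b, rfl, hbu, hbv⟩ := hlift b hb
  obtain ⟨c, rfl, hcu, hcv⟩ := hlift c hc
  obtain ⟨d, rfl, hdu, hdv⟩ := hlift d hd
  rw [hfree a b c d (hf.adj_of_map_adj hau hav hbu hbv hab)
    (hf.adj_of_map_adj hbu hbv hcu hcv hbc) (hf.adj_of_map_adj hcu hcv hdu hdv hcd)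
    (hf.adj_of_map_adj hdu hdv hau hav hda) fun h => hac (h ▸ rfl)]

end HalinGraph

theorem exists_isContraction {V : Type*} [Fintype V] {u v : V} (huv : u ≠ v) :
    ∃ f : V → Fin (Fintype.card V - 1), IsContraction f u v := by
  classical
  have hcard : Fintype.card {x : V // x ≠ v} = Fintype.card V - 1 :=
    Set.card_ne_eq v
  let e := Fintype.equivFinOfCardEq hcard
  let r : V → {x : V // x ≠ v} := fun x => if h : x = v then ⟨u, huv⟩ else ⟨x, h⟩
  refine ⟨fun x => e (r x), fun b => ⟨(e.symm b).1, ?_⟩, fun x y => ?_⟩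
  · have hb : r (e.symm b).1 = e.symm b := dif_neg (e.symm b).2
    change e (r (e.symm b).1) = b
    rw [hb, Equiv.apply_symm_apply]
  · rw [e.apply_eq_iff_eq]
    grind

/-- Let `e = uv` be a tree edge of an `n`-vertex `C₄`-free Halin graph whose endpoints
are both non-leaves.  If both bounded faces incident to `e` have size at least `6`
(i.e. every outer-cycle edge whose tree path passes through `e` is at tree distance
at least `5`), then there is an `(n-1)`-vertex `C₄`-free Halin graph with exactly
one fewer edge. -/
theorem reduce_contract_edge {V : Type*} [Fintype V] (H : HalinGraph V)
    (hfree : C4Free H.graph) (u v : V) (huv : H.T.Adj u v)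
    (hu : ¬ IsLeaf H.T u) (hv : ¬ IsLeaf H.T v)
    (hfaces : ∀ w1 w2 : V, H.C.Adj w1 w2 →
      (∀ p : H.T.Walk w1 w2, p.IsPath → s(u, v) ∈ p.edges) →
      6 ≤ H.T.dist w1 w2 + 1) :
    ∃ H' : HalinGraph (Fin (Fintype.card V - 1)),
      C4Free H'.graph ∧ eCount H.graph = eCount H'.graph + 1 := by
  have hface : ∀ w₁ w₂ : V, H.C.Adj w₁ w₂ → ∀ p : H.T.Walk w₁ w₂, p.IsPath →
      s(u, v) ∈ p.edges → 5 ≤ p.length := by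
    intro w₁ w₂ hw p hp hmem
    have hdist := hfaces w₁ w₂ hw fun q hq => by
      have hqp : q = p :=
        congrArg Subtype.val ((H.tree_isTree.isAcyclic.subsingleton_path w₁ w₂).elim ⟨q, hq⟩ ⟨p, hp⟩)
      rwa [hqp]
    have := dist_le p
    omega
  obtain ⟨f, hf⟩ := exists_isContraction huv.ne
  have hcard : Fintype.card (Fin (Fintype.card V - 1)) + 1 = Fintype.card V := by
    have := H.four_le_card
    rw [Fintype.card_fin]
    omega
  exact ⟨H.contract hf hcard huv hu hv, H.c4Free_contract hf hcard huv hu hv hfree hface,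
    H.eCount_contract_graph hf hcard huv hu hv⟩
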